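/- Let H be a complex Hilbert space and let T, W be bounded operators on H with ‖W‖ ≤ 1. If |T| = WT, then T = W*|T|. If moreover W is an orthogonal projection, then T is positive. -/

import Mathlib

open ContinuousLinearMap

noncomputable def absOp {H K : Type*} [NormedAddCommGroup H] [InnerProductSpace ℂ H]
    [CompleteSpace H] [NormedAddCommGroup K] [InnerProductSpace ℂ K] [CompleteSpace K]
    (T : H →L[ℂ] K) : H →L[ℂ] H :=
  CFC.sqrt (ContinuousLinearMap.adjoint T ∘L T)

variable {H : Type*} [NormedAddCommGroup H] [InnerProductSpace ℂ H] [CompleteSpace H]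

theorem absOp_nonneg {K : Type*} [NormedAddCommGroup K] [InnerProductSpace ℂ K] [CompleteSpace K]
    (T : H →L[ℂ] K) : 0 ≤ absOp T :=
  CFC.sqrt_nonneg _

theorem norm_absOp_apply {K : Type*} [NormedAddCommGroup K] [InnerProductSpace ℂ K] [CompleteSpace K]
    (T : H →L[ℂ] K) (x : H) : ‖absOp T x‖ = ‖T x‖ := by
  have hpos : 0 ≤ ContinuousLinearMap.adjoint T ∘L T :=
    (ContinuousLinearMap.nonneg_iff_isPositive _).2 (isPositive_adjoint_comp_self T)
  have hsq : ContinuousLinearMap.adjoint (absOp T) ∘L absOp T =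
      ContinuousLinearMap.adjoint T ∘L T := by
    have hsa : ContinuousLinearMap.adjoint (absOp T) = absOp T :=
      (IsSelfAdjoint.of_nonneg (absOp_nonneg T)).star_eq
    rw [hsa]
    exact CFC.sqrt_mul_sqrt_self _ hpos
  rw [apply_norm_eq_sqrt_inner_adjoint_left, hsq, ← apply_norm_eq_sqrt_inner_adjoint_left]

theorem stmt8 (T W : H →L[ℂ] H) (hW : ‖W‖ ≤ 1) (h : absOp T = W ∘L T) :
    T = ContinuousLinearMap.adjoint W ∘L absOp T ∧
      ((IsSelfAdjoint W ∧ W ∘L W = W) → T.IsPositive) := by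
  have hT : T = ContinuousLinearMap.adjoint W ∘L absOp T := by
    ext x
    have hn := norm_absOp_apply T x
    have hin : inner ℂ (T x) (ContinuousLinearMap.adjoint W (absOp T x)) =
        (‖T x‖ : ℂ) ^ 2 := by
      rw [adjoint_inner_right, ← ContinuousLinearMap.comp_apply, ← h,
        inner_self_eq_norm_sq_to_K, hn]
      rfl
    have hle : ‖ContinuousLinearMap.adjoint W (absOp T x)‖ ≤ ‖T x‖ := by
      rw [← hn]
      refine ContinuousLinearMap.le_of_opNorm_le _ ?_ _ |>.trans_eq (one_mul _)
      rwa [LinearIsometryEquiv.norm_map]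
    have hsub := norm_sub_sq (𝕜 := ℂ) (T x) (ContinuousLinearMap.adjoint W (absOp T x))
    rw [hin, ← Complex.ofReal_pow, RCLike.re_eq_complex_re, Complex.ofReal_re] at hsub
    have hz : ‖T x - ContinuousLinearMap.adjoint W (absOp T x)‖ ^ 2 ≤ 0 := by
      have := pow_le_pow_left₀ (norm_nonneg _) hle 2
      linarith
    exact sub_eq_zero.1 (norm_eq_zero.1 (pow_eq_zero_iff two_ne_zero |>.1
      (le_antisymm hz (sq_nonneg _))))
  refine ⟨hT, fun ⟨hsa, hid⟩ => ?_⟩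
  have hadj : ContinuousLinearMap.adjoint W = W := hsa.star_eq
  have hTabs : T = absOp T := by
    conv_lhs => rw [hT, hadj, h, ← ContinuousLinearMap.comp_assoc, hid, ← h]
  rw [hTabs]
  exact (ContinuousLinearMap.nonneg_iff_isPositive _).1 (absOp_nonneg T)
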